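/- Simple group privacy for P-PRzCDP (Lemma 4): Let T be a record set, P : T → [0,∞) a policy function, and let M be a mechanism satisfying P-PRzCDP. Let J ≥ 1 and let D₀, D₁, …, D_J be databases over T such that for each j ∈ {1,…,J}, D_j and D_{j−1} differ in the record r_j. Then for all α ∈ (1,∞), D_α(M(D₀)‖M(D_J)) ≤ α · J · Σ_{j=1}^{J} P(r_j). -/

import Mathlib

open MeasureTheory ProbabilityTheory
open scoped Classical NNReal

/-- Rényi divergence of order `α` between two measures. -/
noncomputable def renyiDiv {X : Type*} [MeasurableSpace X] (α : ℝ) (P Q : Measure X) : EReal :=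
  if P ≪ Q then (((α - 1)⁻¹ : ℝ) : EReal) * ENNReal.log (∫⁻ x, P.rnDeriv Q x ^ α ∂Q)
  else ⊤

/-- Databases `D` and `D'` differ in the single record `r`. -/
def Neighbors {T : Type*} (D D' : Multiset T) (r : T) : Prop :=
  D' = r ::ₘ D ∨ D = r ::ₘ D'

/-- Per-record zero-concentrated differential privacy with policy function `P`. -/
def PRzCDP {T Y : Type*} [MeasurableSpace Y] (M : Multiset T → Measure Y) (P : T → ℝ) : Prop :=
  ∀ α : ℝ, 1 < α → ∀ (D D' : Multiset T) (r : T), Neighbors D D' r →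
    renyiDiv α (M D) (M D') ≤ ((α * P r : ℝ) : EReal)

/-- Zero-concentrated differential privacy with privacy-loss parameter `ρ`. -/
def zCDP {T Y : Type*} [MeasurableSpace Y] (M : Multiset T → Measure Y) (ρ : ℝ) : Prop :=
  ∀ α : ℝ, 1 < α → ∀ (D D' : Multiset T) (r : T), Neighbors D D' r →
    renyiDiv α (M D) (M D') ≤ ((ρ * α : ℝ) : EReal)

open scoped ENNReal

theorem renyiDiv_le_coe_iff {X : Type*} [MeasurableSpace X] {α : ℝ} (hα : 1 < α)
    (P Q : Measure X) (c : ℝ) :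
    renyiDiv α P Q ≤ (c : EReal) ↔
      P ≪ Q ∧ ∫⁻ x, P.rnDeriv Q x ^ α ∂Q ≤ ENNReal.ofReal (Real.exp ((α - 1) * c)) := by
  have hα' : 0 < α - 1 := sub_pos.2 hα
  unfold renyiDiv
  split_ifs with h
  · rw [← ENNReal.log_rpow, ← EReal.log_exp (c : EReal), ENNReal.log_le_log_iff,
      ENNReal.rpow_inv_le_iff hα', EReal.exp_coe, ENNReal.ofReal_rpow_of_pos (Real.exp_pos c),
      ← Real.exp_mul, mul_comm c]
    exact (and_iff_right h).symm
  · simp [h]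

/-- Hölder's inequality for the integral defining the Rényi divergence, with an intermediate
measure `S`. -/
theorem lintegral_rnDeriv_rpow_le {X : Type*} [MeasurableSpace X] (P S Q : Measure X)
    [SigmaFinite P] [SigmaFinite S] [SigmaFinite Q] (hPS : P ≪ S) (hSQ : S ≪ Q)
    {α p q : ℝ} (hα : 1 < α) (hpq : p.HolderConjugate q) :
    ∫⁻ x, P.rnDeriv Q x ^ α ∂Q ≤
      (∫⁻ x, P.rnDeriv S x ^ (α * p) ∂S) ^ (1 / p) *
        (∫⁻ x, S.rnDeriv Q x ^ ((α - 1 / p) * q) ∂Q) ^ (1 / q) := by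
  have hp : 0 < p := hpq.pos
  have hp1 : 1 / p < 1 := (div_lt_one hp).2 hpq.lt
  have hmPS : Measurable (P.rnDeriv S) := Measure.measurable_rnDeriv P S
  have hmSQ : Measurable (S.rnDeriv Q) := Measure.measurable_rnDeriv S Q
  calc ∫⁻ x, P.rnDeriv Q x ^ α ∂Q
      = ∫⁻ x, ((fun y => P.rnDeriv S y ^ α * S.rnDeriv Q y ^ (1 / p)) *
          fun y => S.rnDeriv Q y ^ (α - 1 / p)) x ∂Q := by
        refine lintegral_congr_ae ?_
        filter_upwards [Measure.rnDeriv_mul_rnDeriv (κ := Q) hPS] with x hx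
        rw [← hx, Pi.mul_apply, Pi.mul_apply, ENNReal.mul_rpow_of_nonneg _ _ (by linarith),
          mul_assoc, ← ENNReal.rpow_add_of_nonneg _ _ (by positivity) (by linarith),
          add_sub_cancel]
    _ ≤ (∫⁻ x, (P.rnDeriv S x ^ α * S.rnDeriv Q x ^ (1 / p)) ^ p ∂Q) ^ (1 / p) *
          (∫⁻ x, (S.rnDeriv Q x ^ (α - 1 / p)) ^ q ∂Q) ^ (1 / q) :=
        ENNReal.lintegral_mul_le_Lp_mul_Lq Q hpq
          ((hmPS.pow_const _).mul (hmSQ.pow_const _)).aemeasurable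
          (hmSQ.pow_const _).aemeasurable
    _ = _ := by
        rw [← lintegral_rnDeriv_mul hSQ (hmPS.pow_const (α * p)).aemeasurable]
        simp_rw [ENNReal.mul_rpow_of_nonneg _ _ hp.le, ← ENNReal.rpow_mul,
          one_div_mul_cancel hp.ne', ENNReal.rpow_one, mul_comm (S.rnDeriv Q _)]

/-- Approximate triangle inequality for Rényi divergences that grow linearly in the order. -/
theorem renyiDiv_le_of_forall_le_mul {X : Type*} [MeasurableSpace X] (P S Q : Measure X)
    [SigmaFinite P] [SigmaFinite S] [SigmaFinite Q] {a b s : ℝ} (hs : 0 < s)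
    (hPS : ∀ β : ℝ, 1 < β → renyiDiv β P S ≤ ((β * a : ℝ) : EReal))
    (hSQ : ∀ β : ℝ, 1 < β → renyiDiv β S Q ≤ ((β * b : ℝ) : EReal))
    {α : ℝ} (hα : 1 < α) :
    renyiDiv α P Q ≤ ((α * ((1 + s) * a + (1 + 1 / s) * b) : ℝ) : EReal) := by
  have hα' : 0 < α - 1 := sub_pos.2 hα
  have hα0 : 0 < α := by linarith
  obtain ⟨t, ht⟩ : ∃ t, t = (α - 1) / α * s := ⟨_, rfl⟩
  have ht0 : 0 < t := by rw [ht]; positivity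
  have hpq : (1 + t).HolderConjugate ((1 + t) / t) := by
    rw [Real.holderConjugate_iff]
    exact ⟨by linarith, by field_simp⟩
  have hβ : 1 < α * (1 + t) := by nlinarith
  have hγ' : (α - 1 / (1 + t)) * ((1 + t) / t) = 1 + (α - 1) * (1 + t) / t := by
    field_simp
    ring
  have hγ : 1 < (α - 1 / (1 + t)) * ((1 + t) / t) := by
    rw [hγ']
    have : 0 < (α - 1) * (1 + t) / t := by positivity
    linarith
  obtain ⟨hac₁, h₁⟩ := (renyiDiv_le_coe_iff hβ P S _).1 (hPS _ hβ)
  obtain ⟨hac₂, h₂⟩ := (renyiDiv_le_coe_iff hγ S Q _).1 (hSQ _ hγ)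
  refine (renyiDiv_le_coe_iff hα P Q _).2 ⟨hac₁.trans hac₂, ?_⟩
  refine (lintegral_rnDeriv_rpow_le P S Q hac₁ hac₂ hα hpq).trans ?_
  have hp0 : 0 ≤ 1 / (1 + t) := by positivity
  have hq0 : 0 ≤ 1 / ((1 + t) / t) := by positivity
  refine (mul_le_mul' (ENNReal.rpow_le_rpow h₁ hp0) (ENNReal.rpow_le_rpow h₂ hq0)).trans_eq ?_
  rw [ENNReal.ofReal_rpow_of_pos (Real.exp_pos _), ENNReal.ofReal_rpow_of_pos (Real.exp_pos _),
    ← ENNReal.ofReal_mul (Real.rpow_nonneg (Real.exp_pos _).le _), ← Real.exp_mul,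
    ← Real.exp_mul, ← Real.exp_add, hγ']
  congr 2
  have hs' : s = α * t / (α - 1) := by rw [ht]; field_simp
  rw [hs']
  field_simp
  ring

/-- Simple group privacy for P-PRzCDP (Lemma 4). -/
theorem przcdp_simple_group_privacy {T Y : Type*} [MeasurableSpace Y]
    (P : T → ℝ) (hP : ∀ r, 0 ≤ P r)
    (M : Multiset T → Measure Y) (hMprob : ∀ D, IsProbabilityMeasure (M D))
    (hM : PRzCDP M P) (J : ℕ) (hJ : 1 ≤ J)
    (D : Fin (J + 1) → Multiset T) (r : Fin J → T)
    (hD : ∀ j : Fin J, Neighbors (D j.castSucc) (D j.succ) (r j)) :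
    ∀ α : ℝ, 1 < α →
      renyiDiv α (M (D 0)) (M (D (Fin.last J))) ≤
        ((α * J * ∑ j : Fin J, P (r j) : ℝ) : EReal) := by
  induction J, hJ using Nat.le_induction with
  | base =>
    intro α hα
    simpa using hM α hα _ _ _ (hD 0)
  | succ n hn ih =>
    intro α hα
    have hn0 : (0 : ℝ) < n := by exact_mod_cast hn
    have hinit : ∀ β : ℝ, 1 < β → renyiDiv β (M (D 0)) (M (D (Fin.last n).castSucc)) ≤
        ((β * (n * ∑ j : Fin n, P (r j.castSucc)) : ℝ) : EReal) := by
      intro β hβ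
      rw [← mul_assoc]
      exact ih (fun j => D j.castSucc) (fun j => r j.castSucc) (fun j => hD j.castSucc) β hβ
    have hlast : ∀ β : ℝ, 1 < β →
        renyiDiv β (M (D (Fin.last n).castSucc)) (M (D (Fin.last (n + 1)))) ≤
          ((β * P (r (Fin.last n)) : ℝ) : EReal) :=
      fun β hβ => hM β hβ _ _ _ (hD (Fin.last n))
    refine (renyiDiv_le_of_forall_le_mul _ _ _ (one_div_pos.2 hn0) hinit hlast hα).trans_eq ?_
    rw [Fin.sum_univ_castSucc]
    congr 1
    push_cast
    field_simp
    ring
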